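/- Let S be an unbounded characteristic subset of [0, ∞) and let X be a strongly 0-dimensional, σ-compact, locally compact metrizable topological space. Then there exists a proper ultrametric on X taking values in S and generating the topology of X. In particular, X is completely ultrametrizable. -/

import Mathlib

/-- An ultrametric (given as a distance function) on a topological space that
generates its topology. -/
def IsUltrametricGen {X : Type*} [TopologicalSpace X] (d : X → X → ℝ) : Prop :=
  (∀ x y, 0 ≤ d x y) ∧
  (∀ x y, d x y = 0 ↔ x = y) ∧
  (∀ x y, d x y = d y x) ∧
  (∀ x y z, d x z ≤ max (d x y) (d y z)) ∧
  (∀ s : Set X, IsOpen s ↔ ∀ x ∈ s, ∃ ε > 0, ∀ y, d x y < ε → y ∈ s)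

/-- A metric is proper if every bounded closed subset is compact. -/
def IsProperMetric {X : Type*} [TopologicalSpace X] (d : X → X → ℝ) : Prop :=
  ∀ s : Set X, IsClosed s → (∃ C, ∀ x ∈ s, ∀ y ∈ s, d x y ≤ C) → IsCompact s

/-- A metric is complete if every Cauchy sequence converges. -/
def IsCompleteMetric {X : Type*} (d : X → X → ℝ) : Prop :=
  ∀ u : ℕ → X, (∀ ε : ℝ, 0 < ε → ∃ N, ∀ m ≥ N, ∀ n ≥ N, d (u m) (u n) < ε) →
    ∃ x : X, ∀ ε : ℝ, 0 < ε → ∃ N, ∀ n ≥ N, d x (u n) < ε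

/-- `S` is a characteristic subset of `[0, ∞)`. -/
def IsCharacteristic (S : Set ℝ) : Prop :=
  S ⊆ Set.Ici 0 ∧ (0 : ℝ) ∈ S ∧ ∀ r : ℝ, 0 < r → ∃ s ∈ S, s ≠ 0 ∧ s ≤ r

/-- A topological space is strongly 0-dimensional if every pair of disjoint
closed sets can be separated by a clopen set. -/
def StronglyZeroDimensional (X : Type*) [TopologicalSpace X] : Prop :=
  ∀ A B : Set X, IsClosed A → IsClosed B → Disjoint A B →
    ∃ V : Set X, IsClopen V ∧ A ⊆ V ∧ Disjoint V B

open Set Filter Topology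

section SeparationDist

variable {X : Type*}

/-- The distance of two points is `s n`, where `n` is the first index for which `U n` separates
them, and `0` if there is no such index. -/
noncomputable def separationDist (U : ℕ → Set X) (s : ℕ → ℝ) (x y : X) : ℝ :=
  open Classical in
  if ∃ n, ¬(x ∈ U n ↔ y ∈ U n) then s (sInf {n | ¬(x ∈ U n ↔ y ∈ U n)}) else 0

theorem le_separationDist {U : ℕ → Set X} {s : ℕ → ℝ} (hs : Antitone s) {x y : X} {n : ℕ}
    (h : ¬(x ∈ U n ↔ y ∈ U n)) : s n ≤ separationDist U s x y := by
  rw [separationDist, if_pos ⟨n, h⟩]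
  exact hs (Nat.sInf_le h)

theorem separationDist_cases (U : ℕ → Set X) (s : ℕ → ℝ) (x y : X) :
    separationDist U s x y = 0 ∨
      ∃ n, ¬(x ∈ U n ↔ y ∈ U n) ∧ separationDist U s x y = s n := by
  by_cases hex : ∃ n, ¬(x ∈ U n ↔ y ∈ U n)
  · exact Or.inr ⟨_, Nat.sInf_mem hex, if_pos hex⟩
  · exact Or.inl (by rw [separationDist, if_neg hex])

theorem separationDist_self (U : ℕ → Set X) (s : ℕ → ℝ) (x : X) :
    separationDist U s x x = 0 := by
  simp [separationDist]

theorem separationDist_comm (U : ℕ → Set X) (s : ℕ → ℝ) (x y : X) :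
    separationDist U s x y = separationDist U s y x := by
  unfold separationDist
  congr! 4
  · exact iff_comm
  · exact funext fun n => congrArg Not (propext iff_comm)

theorem separationDist_nonneg (U : ℕ → Set X) {s : ℕ → ℝ} (hs : ∀ n, 0 < s n) (x y : X) :
    0 ≤ separationDist U s x y := by
  obtain h | ⟨n, -, h⟩ := separationDist_cases U s x y
  · exact h.ge
  · exact h ▸ (hs n).le

theorem separationDist_triangle (U : ℕ → Set X) {s : ℕ → ℝ} (hs : Antitone s)
    (hpos : ∀ n, 0 < s n) (x y z : X) :
    separationDist U s x z ≤ max (separationDist U s x y) (separationDist U s y z) := by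
  obtain h | ⟨n, hn, h⟩ := separationDist_cases U s x z
  · exact h ▸ le_max_of_le_left (separationDist_nonneg U hpos x y)
  · rw [h]
    by_cases hxy : x ∈ U n ↔ y ∈ U n
    · exact le_max_of_le_right (le_separationDist hs fun hyz => hn (hxy.trans hyz))
    · exact le_max_of_le_left (le_separationDist hs hxy)

theorem eventually_separationDist_lt [TopologicalSpace X] {U : ℕ → Set X}
    (hU : ∀ n, IsClopen (U n)) {s : ℕ → ℝ} (hs : Antitone s) (hlim : Tendsto s atTop (𝓝 0))
    (x : X) {ε : ℝ} (hε : 0 < ε) : ∀ᶠ y in 𝓝 x, separationDist U s x y < ε := by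
  obtain ⟨N, hN⟩ := (hlim.eventually_lt_const hε).exists
  have hmem (n : ℕ) : ∀ᶠ y in 𝓝 x, (x ∈ U n ↔ y ∈ U n) := by
    by_cases hx : x ∈ U n
    · filter_upwards [(hU n).isOpen.mem_nhds hx] with y hy using iff_of_true hx hy
    · filter_upwards [(hU n).compl.isOpen.mem_nhds hx] with y hy using iff_of_false hx hy
  filter_upwards [(eventually_all_finite (finite_le_nat N)).2 fun n _ => hmem n] with y hy
  obtain h | ⟨n, hn, h⟩ := separationDist_cases U s x y
  · exact h ▸ hε
  · have hNn : N ≤ n := (not_le.1 fun hle => hn (hy n hle)).le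
    exact h ▸ (hs hNn).trans_lt hN

end SeparationDist

section WeightDist

variable {X : Type*}

/-- The distance of two points of different weight is the larger of their weights, and `0` if the
weights agree. -/
noncomputable def weightDist (w : X → ℝ) (x y : X) : ℝ :=
  if w x = w y then 0 else max (w x) (w y)

theorem weightDist_comm (w : X → ℝ) (x y : X) : weightDist w x y = weightDist w y x := by
  simp only [weightDist, eq_comm, max_comm]

theorem weightDist_triangle {w : X → ℝ} (hw : ∀ x, 0 ≤ w x) (x y z : X) :
    weightDist w x z ≤ max (weightDist w x y) (weightDist w y z) := by
  have := hw x
  have := hw y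
  have := hw z
  unfold weightDist
  grind

theorem weight_le_max_weightDist (w : X → ℝ) (x y : X) :
    w y ≤ max (w x) (weightDist w x y) := by
  unfold weightDist
  grind

end WeightDist

/-- In a strongly zero-dimensional, locally compact, second countable Hausdorff space, the
compact open sets contain a countable basis. -/
theorem StronglyZeroDimensional.exists_seq_isClopen_isCompact {X : Type*} [TopologicalSpace X]
    [T2Space X] [LocallyCompactSpace X] [SecondCountableTopology X]
    (hX : StronglyZeroDimensional X) :
    ∃ U : ℕ → Set X, (∀ n, IsClopen (U n)) ∧ (∀ n, IsCompact (U n)) ∧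
      ∀ x O, IsOpen O → x ∈ O → ∃ n, x ∈ U n ∧ U n ⊆ O := by
  have hbasis : TopologicalSpace.IsTopologicalBasis {V : Set X | IsClopen V ∧ IsCompact V} := by
    refine TopologicalSpace.isTopologicalBasis_of_isOpen_of_nhds (fun V hV => hV.1.isOpen) ?_
    intro x O hx hO
    obtain ⟨K, hK, hxK, hKO⟩ := exists_compact_subset hO hx
    obtain ⟨V, hV, hxV, hVK⟩ := hX {x} (interior K)ᶜ isClosed_singleton
      isOpen_interior.isClosed_compl (by simpa using hxK)
    have hVK' : V ⊆ K := (disjoint_compl_right_iff_subset.1 hVK).trans interior_subset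
    exact ⟨V, ⟨hV, hK.of_isClosed_subset hV.isClosed hVK'⟩, hxV rfl, hVK'.trans hKO⟩
  obtain ⟨B, hBsub, hBc, hB⟩ := hbasis.exists_countable
  obtain ⟨U, hU⟩ := (hBc.insert ∅).exists_eq_range (insert_nonempty _ _)
  have hmem (n : ℕ) : IsClopen (U n) ∧ IsCompact (U n) := by
    have h : U n ∈ insert ∅ B := hU ▸ mem_range_self n
    obtain h | h := h
    · exact h ▸ ⟨isClopen_empty, isCompact_empty⟩
    · exact hBsub h
  refine ⟨U, fun n => (hmem n).1, fun n => (hmem n).2, fun x O hO hx => ?_⟩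
  obtain ⟨V, hVB, hxV, hVO⟩ := hB.exists_subset_of_mem_open hx hO
  obtain ⟨n, rfl⟩ : V ∈ range U := hU ▸ mem_insert_of_mem _ hVB
  exact ⟨n, hxV, hVO⟩

/-- A sequence of compact open sets covering the space yields a locally constant weight with
values in a given unbounded set and relatively compact sublevel sets. -/
theorem exists_weight_of_iUnion_eq_univ {X : Type*} [TopologicalSpace X] {U : ℕ → Set X}
    (hU : ∀ n, IsClopen (U n)) (hc : ∀ n, IsCompact (U n)) (hcov : ∀ x, ∃ n, x ∈ U n)
    {S : Set ℝ} (hSu : ¬ BddAbove S) :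
    ∃ w : X → ℝ, (∀ x, w x ∈ S) ∧ (∀ x, ∀ᶠ y in 𝓝 x, w x = w y) ∧
      ∀ C, ∃ K, IsCompact K ∧ ∀ x, w x ≤ C → x ∈ K := by
  classical
  choose t htS ht using fun n : ℕ => not_bddAbove_iff.1 hSu n
  refine ⟨fun x => t (Nat.find (hcov x)), fun x => htS _, fun x => ?_, fun C => ?_⟩
  · have hlt : ∀ᶠ y in 𝓝 x, ∀ m ∈ Iio (Nat.find (hcov x)), y ∉ U m :=
      (eventually_all_finite (finite_lt_nat _)).2 fun m hm =>
        (hU m).compl.isOpen.mem_nhds (Nat.find_min (hcov x) hm)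
    filter_upwards [hlt, (hU _).isOpen.mem_nhds (Nat.find_spec (hcov x))] with y hy hyU
    rw [((Nat.find_eq_iff (hcov y)).2 ⟨hyU, hy⟩)]
  · refine ⟨⋃ n ∈ Iic ⌈C⌉₊, U n, (finite_Iic _).isCompact_biUnion fun n _ => hc n, ?_⟩
    intro x hx
    have h : (Nat.find (hcov x) : ℝ) ≤ ⌈C⌉₊ := ((ht _).le.trans hx).trans (Nat.le_ceil C)
    exact mem_biUnion (mem_Iic.2 (Nat.cast_le.1 h)) (Nat.find_spec (hcov x))

theorem IsCharacteristic.exists_antitone_tendsto {S : Set ℝ} (hS : IsCharacteristic S) :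
    ∃ s : ℕ → ℝ, (∀ n, s n ∈ S) ∧ (∀ n, 0 < s n) ∧ Antitone s ∧ Tendsto s atTop (𝓝 0) := by
  have hex (r : ℝ) (hr : 0 < r) : ∃ a ∈ S, 0 < a ∧ a ≤ r := by
    obtain ⟨a, ha, ha0, har⟩ := hS.2.2 r hr
    exact ⟨a, ha, (hS.1 ha).lt_of_ne' ha0, har⟩
  choose f hfS hfpos hfle using hex
  let g : ℕ → {a : ℝ // a ∈ S ∧ 0 < a} := fun n =>
    Nat.rec ⟨f 1 one_pos, hfS _ _, hfpos _ _⟩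
      (fun n a => ⟨f (min a.1 (1 / ((n : ℝ) + 1))) (lt_min a.2.2 (by positivity)),
        hfS _ _, hfpos _ _⟩) n
  have hg (n : ℕ) : (g (n + 1)).1 ≤ min (g n).1 (1 / ((n : ℝ) + 1)) := hfle _ _
  refine ⟨fun n => (g n).1, fun n => (g n).2.1, fun n => (g n).2.2,
    antitone_nat_of_succ_le fun n => (hg n).trans (min_le_left _ _), ?_⟩
  rw [← tendsto_add_atTop_iff_nat 1]
  exact squeeze_zero (fun n => (g (n + 1)).2.2.le) (fun n => (hg n).trans (min_le_right _ _))
    tendsto_one_div_add_atTop_nhds_zero_nat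

theorem IsUltrametricGen.eventually_lt {X : Type*} [TopologicalSpace X] {d : X → X → ℝ}
    (hd : IsUltrametricGen d) (x : X) {ε : ℝ} (hε : 0 < ε) : ∀ᶠ y in 𝓝 x, d x y < ε := by
  obtain ⟨-, h0, -, htri, hopen⟩ := hd
  refine IsOpen.mem_nhds ((hopen {y | d x y < ε}).2 fun y hy => ⟨ε, hε, fun z hz => ?_⟩) ?_
  · exact (htri x y z).trans_lt (max_lt hy hz)
  · simpa [(h0 x x).2 rfl] using hε

theorem IsProperMetric.isCompleteMetric {X : Type*} [TopologicalSpace X] {d : X → X → ℝ}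
    (hd : IsUltrametricGen d) (hp : IsProperMetric d) : IsCompleteMetric d := by
  intro u hu
  obtain ⟨-, h0, hsymm, htri, hopen⟩ := id hd
  obtain ⟨N, hN⟩ := hu 1 one_pos
  have hclosed : IsClosed {y | d (u N) y < 1} := by
    refine ⟨(hopen _).2 fun x hx => ⟨1, one_pos, fun y hxy hy => hx ?_⟩⟩
    exact (htri (u N) y x).trans_lt (max_lt hy (hsymm x y ▸ hxy))
  have hcompact : IsCompact {y | d (u N) y < 1} := by
    refine hp _ hclosed ⟨1, fun x hx y hy => (htri x (u N) y).trans ?_⟩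
    exact max_le (hsymm x (u N) ▸ (le_of_lt hx)) (le_of_lt hy)
  obtain ⟨x, -, hx⟩ := hcompact.exists_mapClusterPt_of_frequently
    (eventually_atTop.2 ⟨N, fun n hn => hN N le_rfl n hn⟩ :
      ∀ᶠ n in atTop, u n ∈ {y | d (u N) y < 1}).frequently
  refine ⟨x, fun ε hε => ?_⟩
  obtain ⟨M, hM⟩ := hu ε hε
  obtain ⟨m, hm, hxm⟩ := frequently_atTop.1 (hx.frequently (hd.eventually_lt x hε)) M
  exact ⟨M, fun n hn => (htri x (u m) (u n)).trans_lt (max_lt hxm (hM m hm n hn))⟩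

/-- **Existence of proper ultrametrics.** Let `S` be an unbounded characteristic
subset of `[0, ∞)`. Every strongly 0-dimensional σ-compact locally compact
metrizable space admits a proper `S`-valued ultrametric generating its topology;
in particular it is completely ultrametrizable. -/
theorem exists_proper_ultrametric
    {X : Type*} [TopologicalSpace X] [TopologicalSpace.MetrizableSpace X]
    [SigmaCompactSpace X] [LocallyCompactSpace X]
    (hX : StronglyZeroDimensional X)
    (S : Set ℝ) (hS : IsCharacteristic S) (hSu : ¬ BddAbove S) :
    ∃ D : X → X → ℝ, IsUltrametricGen D ∧ (∀ x y, D x y ∈ S) ∧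
      IsProperMetric D ∧ IsCompleteMetric D := by
  have : SecondCountableTopology X := by
    let := TopologicalSpace.metrizableSpaceMetric X
    exact EMetric.secondCountable_of_sigmaCompact X
  obtain ⟨U, hU, hUc, hUb⟩ := hX.exists_seq_isClopen_isCompact
  have hcov (x : X) : ∃ n, x ∈ U n := (hUb x univ isOpen_univ (mem_univ x)).imp fun _ h => h.1
  obtain ⟨w, hwS, hwloc, hwK⟩ := exists_weight_of_iUnion_eq_univ hU hUc hcov hSu
  obtain ⟨s, hsS, hspos, hsanti, hslim⟩ := hS.exists_antitone_tendsto
  have hw (x : X) : 0 ≤ w x := hS.1 (hwS x)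
  let D : X → X → ℝ := fun x y => max (separationDist U s x y) (weightDist w x y)
  have hDlt (x : X) {ε : ℝ} (hε : 0 < ε) : ∀ᶠ y in 𝓝 x, D x y < ε := by
    filter_upwards [hwloc x, eventually_separationDist_lt hU hsanti hslim x hε] with y hxy hy
    exact max_lt hy (by rwa [weightDist, if_pos hxy])
  have hmem {x y : X} {n : ℕ} (hx : x ∈ U n) (hxy : D x y < s n) : y ∈ U n := by
    by_contra hy
    have hsep : s n ≤ separationDist U s x y := le_separationDist hsanti fun h => hy (h.1 hx)
    exact (hsep.trans (le_max_left _ _)).not_gt hxy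
  have hD : IsUltrametricGen D := by
    refine ⟨fun x y => le_max_of_le_left (separationDist_nonneg U hspos x y), fun x y => ⟨?_, ?_⟩,
      fun x y => ?_, fun x y z => ?_, fun O => ⟨fun hO x hx => ?_, fun hO => ?_⟩⟩
    · intro h
      by_contra hne
      obtain ⟨n, hxn, hn⟩ := hUb x {y}ᶜ isOpen_compl_singleton hne
      exact hn (hmem hxn (h ▸ hspos n)) rfl
    · rintro rfl
      simp [D, separationDist_self, weightDist]
    · simp only [D, separationDist_comm U s x y, weightDist_comm w x y]
    · have h₁ := separationDist_triangle U hsanti hspos x y z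
      have h₂ := weightDist_triangle hw x y z
      exact (max_le_max h₁ h₂).trans_eq (max_max_max_comm _ _ _ _)
    · obtain ⟨n, hxn, hn⟩ := hUb x O hO hx
      exact ⟨s n, hspos n, fun y hy => hn (hmem hxn hy)⟩
    · refine isOpen_iff_mem_nhds.2 fun x hx => ?_
      obtain ⟨ε, hε, h⟩ := hO x hx
      exact (hDlt x hε).mono h
  have hproper : IsProperMetric D := by
    rintro A hA ⟨C, hC⟩
    obtain rfl | ⟨x, hx⟩ := A.eq_empty_or_nonempty
    · exact isCompact_empty
    obtain ⟨K, hK, hwK⟩ := hwK (max (w x) C)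
    refine hK.of_isClosed_subset hA fun y hy => hwK y ?_
    exact (weight_le_max_weightDist w x y).trans
      (max_le_max le_rfl ((le_max_right _ _).trans (hC x hx y hy)))
  refine ⟨D, hD, fun x y => ?_, hproper, hproper.isCompleteMetric hD⟩
  have hmax {a b : ℝ} (ha : a ∈ S) (hb : b ∈ S) : max a b ∈ S := by
    obtain h | h := max_choice a b <;> rwa [h]
  refine hmax ?_ ?_
  · obtain h | ⟨n, -, h⟩ := separationDist_cases U s x y
    · exact h ▸ hS.2.1
    · exact h ▸ hsS n
  · unfold weightDist
    split_ifs
    · exact hS.2.1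
    · exact hmax (hwS x) (hwS y)
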